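/- Let $f : X \to Y$ be a surjective simplicial map between finite simplicial complexes such that every fiber $f^{-1}(y)$ is finite with at most $m$ points, and let $i : X \to \mathbb{R}^N$ be an $m$-avoiding embedding. Then the simplicial resolution $f^\Delta : X^\Delta \to Y$, where $X^\Delta = \{(y,z) \in Y \times \mathbb{R}^N : z \in \mathrm{conv}(i(f^{-1}(y)))\}$, is a homotopy equivalence. -/

import Mathlib

open Geometry

/-- A compact set `X ⊆ ℝᴺ` is `m`-avoiding if for any `2m` distinct points
`x₁,…,xₘ,x₁',…,xₘ'` of `X`, the convex hulls of `{x₁,…,xₘ}` and `{x₁',…,xₘ'}`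
are disjoint. -/
def MAvoiding {N : ℕ} (m : ℕ) (X : Set (EuclideanSpace ℝ (Fin N))) : Prop :=
  ∀ s t : Finset (EuclideanSpace ℝ (Fin N)),
    ↑s ⊆ X → ↑t ⊆ X → s.card = m → t.card = m → Disjoint s t →
      Disjoint (convexHull ℝ (s : Set (EuclideanSpace ℝ (Fin N))))
        (convexHull ℝ (t : Set (EuclideanSpace ℝ (Fin N))))


open unitInterval Topology in
theorem rs_assembly {Y V : Type*} [TopologicalSpace Y] [NormedAddCommGroup V] [NormedSpace ℝ V]
    (Φ : Y → Set V) (hΦ : ∀ y, Convex ℝ (Φ y)) (c : C(Y, Y))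
    (hc : (ContinuousMap.id Y).Homotopic c)
    (H : C(I × {p : Y × V // p.2 ∈ Φ p.1}, {p : Y × V // p.2 ∈ Φ p.1}))
    (H0 : ∀ e, H (0, e) = e) (H1 : ∀ e, (H (1, e)).1.1 = c e.1.1)
    (g : C(Y, V)) (hg : ∀ y, g y ∈ Φ (c y)) :
    ∃ h : ContinuousMap.HomotopyEquiv {p : Y × V // p.2 ∈ Φ p.1} Y, ∀ p, h p = p.val.1 := by
  let G : C(Y, {p : Y × V // p.2 ∈ Φ p.1}) :=
    ⟨fun y => ⟨(c y, g y), hg y⟩, by fun_prop⟩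
  let p : C({p : Y × V // p.2 ∈ Φ p.1}, Y) := ⟨fun e => e.1.1, by fun_prop⟩
  let E1 : C({p : Y × V // p.2 ∈ Φ p.1}, {p : Y × V // p.2 ∈ Φ p.1}) :=
    ⟨fun e => H (1, e), by fun_prop⟩
  have h1 : (ContinuousMap.id _).Homotopic E1 :=
    ⟨⟨H, fun e => H0 e, fun e => rfl⟩⟩
  have h2 : (G.comp p).Homotopic E1 := by
    refine ⟨⟨⟨fun q => ⟨(c q.2.1.1, (1 - (q.1 : ℝ)) • g q.2.1.1 + (q.1 : ℝ) • (E1 q.2).1.2), ?_⟩,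
      ?_⟩, ?_, ?_⟩⟩
    · have := (E1 q.2).2
      have h3 : (E1 q.2).1.1 = c q.2.1.1 := H1 _
      rw [h3] at this
      exact hΦ _ (hg _) this (by have := q.1.2.2; linarith) q.1.2.1 (by ring)
    · fun_prop
    · intro e
      simp [G, p]
    · intro e
      apply Subtype.ext
      apply Prod.ext
      · exact (H1 e).symm
      · simp
  refine ⟨⟨p, G, h2.trans h1.symm, ?_⟩, fun _ => rfl⟩
  have : p.comp G = c := by ext y; rfl
  rw [this]
  exact hc.symm

theorem rs_hull_fin {X V : Type*} [AddCommGroup V] [Module ℝ V] (i : X → V) (F : Set X)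
    (hF : F.Finite) (m : ℕ) (hm : F.ncard ≤ m) (z : V) (hz : z ∈ convexHull ℝ (i '' F)) :
    ∃ (x : Fin m → X) (w : Fin m → ℝ), (∀ j, x j ∈ F) ∧ w ∈ stdSimplex ℝ (Fin m) ∧
      ∑ j, w j • i (x j) = z := by
  have hne : F.Nonempty := by
    rw [← Set.image_nonempty (f := i), ← convexHull_nonempty_iff (𝕜 := ℝ)]
    exact ⟨z, hz⟩
  have := hF.to_subtype
  have := hne.to_subtype
  have hcard : Nat.card F ≤ Nat.card (Fin m) := by simpa using hm
  obtain ⟨e, he⟩ : ∃ e : Fin m → F, Function.Surjective e := by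
    have := Fintype.ofFinite F
    rw [Nat.card_eq_fintype_card, Nat.card_eq_fintype_card] at hcard
    obtain ⟨u⟩ := Function.Embedding.nonempty_of_card_le hcard
    exact ⟨Function.invFun u, Function.invFun_surjective u.injective⟩
  let l : (Fin m → ℝ) →ₗ[ℝ] V := ∑ j, (LinearMap.proj (R := ℝ) j).smulRight (i (e j))
  have hl : ∀ w, l w = ∑ j, w j • i (e j) := by intro w; simp [l]
  have hsub : convexHull ℝ (i '' F) ⊆ l '' stdSimplex ℝ (Fin m) := by
    apply convexHull_min
    · rintro _ ⟨x, hx, rfl⟩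
      obtain ⟨j, hj⟩ := he ⟨x, hx⟩
      refine ⟨Pi.single j 1, single_mem_stdSimplex ℝ j, ?_⟩
      rw [hl, Finset.sum_eq_single j]
      · simp [hj]
      · intro b _ hb; simp [hb]
      · simp
    · exact (convex_stdSimplex ℝ _).linear_image l
  obtain ⟨w, hw, rfl⟩ := hsub hz
  exact ⟨fun j => e j, w, fun j => (e j).2, hw, (hl w).symm⟩

theorem rs_indep_push {X V ι : Type*} [Fintype ι] [AddCommGroup V] [Module ℝ V] (i : X → V) (F : Set X)
    (hind : AffineIndependent ℝ (fun x : F => i x)) (x : ι → X) (w : ι → ℝ)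
    (hx : ∀ j, x j ∈ F) (hw : ∑ j, w j = 0) (hs : ∑ j, w j • i (x j) = 0) (R : X → V) :
    ∑ j, w j • R (x j) = 0 := by
  classical
  let x' : ι → F := fun j => ⟨x j, hx j⟩
  let S : Finset F := Finset.univ.image x'
  have hmem : ∀ j ∈ (Finset.univ : Finset ι), x' j ∈ S := fun j _ => Finset.mem_image_of_mem _ (Finset.mem_univ _)
  have key : ∀ Q : X → V, ∑ j, w j • Q (x j) = ∑ e ∈ S, (∑ j with x' j = e, w j) • Q e := by
    intro Q
    rw [← Finset.sum_fiberwise_of_maps_to hmem]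
    refine Finset.sum_congr rfl fun e _ => ?_
    rw [Finset.sum_smul]
    refine Finset.sum_congr rfl fun j hj => ?_
    rw [← (Finset.mem_filter.1 hj).2]
  have h0 := affineIndependent_iff.1 hind S (fun e => ∑ j with x' j = e, w j)
    (by rw [Finset.sum_fiberwise_of_maps_to hmem, hw]) (by rw [← hs, key])
  rw [key]
  exact Finset.sum_eq_zero fun e he => by rw [h0 e he, zero_smul]

open unitInterval Topology in
theorem rs_lift {X Y V : Type*} [TopologicalSpace X] [CompactSpace X] [T2Space X]
    [TopologicalSpace Y] [CompactSpace Y] [T2Space Y]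
    [NormedAddCommGroup V] [NormedSpace ℝ V] (m : ℕ)
    (f : X → Y) (hf : Continuous f) (i : X → V) (hi : Continuous i)
    (hfib : ∀ y, (f ⁻¹' {y}).Finite ∧ (f ⁻¹' {y}).ncard ≤ m)
    (hind : ∀ y, AffineIndependent ℝ (fun x : (f ⁻¹' {y}) => i x))
    (r : C(I × Y, Y)) (R : C(I × X, X)) (hR : ∀ t x, f (R (t, x)) = r (t, f x))
    (hR0 : ∀ x, R (0, x) = x) (hr0 : ∀ y, r (0, y) = y) :
    ∃ H : C(I × {p : Y × V // p.2 ∈ convexHull ℝ (i '' (f ⁻¹' {p.1}))},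
        {p : Y × V // p.2 ∈ convexHull ℝ (i '' (f ⁻¹' {p.1}))}),
      (∀ e, H (0, e) = e) ∧ ∀ t e, (H (t, e)).1.1 = r (t, e.1.1) := by
  let W : Set (Y × (Fin m → X) × stdSimplex ℝ (Fin m)) := {q | ∀ j, f (q.2.1 j) = q.1}
  have hWc : IsClosed W := by
    have : W = ⋂ j, {q | f (q.2.1 j) = q.1} := by ext; simp [W]
    rw [this]
    exact isClosed_iInter fun j => isClosed_eq (by fun_prop) (by fun_prop)
  have : CompactSpace (stdSimplex ℝ (Fin m)) := isCompact_iff_compactSpace.1 (isCompact_stdSimplex ℝ _)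
  have : CompactSpace W := isCompact_iff_compactSpace.1 hWc.isCompact
  let E := {p : Y × V // p.2 ∈ convexHull ℝ (i '' (f ⁻¹' {p.1}))}
  let q : I × W → I × E := fun a => (a.1, ⟨(a.2.1.1, ∑ j, (a.2.1.2.2 : Fin m → ℝ) j • i (a.2.1.2.1 j)),
    mem_convexHull_of_exists_fintype _ _ a.2.1.2.2.2.1 a.2.1.2.2.2.2
      (fun j => ⟨_, a.2.2 j, rfl⟩) rfl⟩)
  let h : I × W → E := fun a => ⟨(r (a.1, a.2.1.1),
      ∑ j, (a.2.1.2.2 : Fin m → ℝ) j • i (R (a.1, a.2.1.2.1 j))),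
    mem_convexHull_of_exists_fintype _ _ a.2.1.2.2.2.1 a.2.1.2.2.2.2
      (fun j => ⟨_, by
        simp only [Set.mem_preimage, Set.mem_singleton_iff]
        rw [hR, a.2.2 j], rfl⟩) rfl⟩
  have hwc : ∀ j, Continuous fun a : I × W => (a.2.1.2.2 : Fin m → ℝ) j := fun j =>
    (continuous_apply j).comp (by fun_prop)
  have hq : Continuous q := by
    refine continuous_fst.prodMk (Continuous.subtype_mk (Continuous.prodMk (by fun_prop) ?_) _)
    exact continuous_finsetSum _ fun j _ => (hwc j).smul (by fun_prop)
  have hh : Continuous h := by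
    refine (Continuous.subtype_mk (Continuous.prodMk (by fun_prop) ?_) _)
    exact continuous_finsetSum _ fun j _ => (hwc j).smul (by fun_prop)
  have hqs : Function.Surjective q := by
    rintro ⟨t, ⟨y, z⟩, hz⟩
    obtain ⟨x, w, hx, hw, rfl⟩ := rs_hull_fin i _ (hfib y).1 m (hfib y).2 z hz
    exact ⟨(t, ⟨(y, x, ⟨w, hw⟩), hx⟩), rfl⟩
  have hquot : IsQuotientMap q := hq.isClosedMap.isQuotientMap hq hqs
  have hwd : ∀ a b, q a = q b → h a = h b := by
    rintro ⟨t, ⟨y, x, w⟩, hx⟩ ⟨t', ⟨y', x', w'⟩, hx'⟩ hab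
    have ht : t = t' := congrArg Prod.fst hab
    have hy : y = y' := congrArg (fun u => u.2.1.1) hab
    have hz : ∑ j, (w : Fin m → ℝ) j • i (x j) = ∑ j, (w' : Fin m → ℝ) j • i (x' j) :=
      congrArg (fun u => u.2.1.2) hab
    subst ht
    subst hy
    apply Subtype.ext
    refine Prod.ext rfl ?_
    have := rs_indep_push (ι := Fin m ⊕ Fin m) i (f ⁻¹' {y}) (hind y) (Sum.elim x x')
      (Sum.elim (w : Fin m → ℝ) (fun j => - (w' : Fin m → ℝ) j))
      (by rintro (j | j); exacts [hx j, hx' j])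
      (by simp [Fintype.sum_sum_type, w.2.2, w'.2.2, Finset.sum_neg_distrib])
      (by simp [Fintype.sum_sum_type, Finset.sum_neg_distrib, hz])
      (fun x => i (R (t, x)))
    simp only [Fintype.sum_sum_type, Sum.elim_inl, Sum.elim_inr, neg_smul,
      Finset.sum_neg_distrib] at this
    simpa [h] using (add_neg_eq_zero.1 this)
  let s := Function.surjInv hqs
  have hs : ∀ a, q (s a) = a := Function.surjInv_eq hqs
  have hcomp : (fun a => h (s a)) ∘ q = h := by
    funext a
    exact hwd _ _ (hs _)
  have hH : ∀ a, h (s (q a)) = h a := fun a => congrFun hcomp a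
  refine ⟨⟨fun a => h (s a), hquot.continuous_iff.2 (by rw [hcomp]; exact hh)⟩, ?_, ?_⟩
  · intro e
    obtain ⟨⟨t, w⟩, ha⟩ := hqs (0, e)
    have ht : t = 0 := congrArg Prod.fst ha
    have he : (q (t, w)).2 = e := congrArg Prod.snd ha
    subst ht
    change h (s (0, e)) = e
    rw [← ha, hH, ← he]
    simp [h, q, hr0, hR0]
  · intro t e
    obtain ⟨⟨t', w⟩, ha⟩ := hqs (t, e)
    have ht : t' = t := congrArg Prod.fst ha
    have he : (q (t', w)).2 = e := congrArg Prod.snd ha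
    subst ht
    change (h (s (t', e))).1.1 = _
    rw [← ha, hH, ← he]

theorem rs_center {V ι : Type*} [NormedAddCommGroup V] [NormedSpace ℝ V] [Finite ι] (S : Set V)
    (A : ι → Set V) (hAc : ∀ s, IsCompact (A s)) (hAx : ∀ s, Convex ℝ (A s))
    (hS : S = ⋃ s, A s) :
    ∃ c : C(S, V), (∀ (y : S) s, (y : V) ∈ A s → c y ∈ A s) ∧
      ∀ y : S, ∃ U ∈ nhds y, ∃ s, ∀ y' ∈ U, c y' ∈ A s := by
  have hSc : CompactSpace S := isCompact_iff_compactSpace.1 (hS ▸ isCompact_iUnion hAc)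
  let U : S → Set S := fun p => {y | ∀ s, (y : V) ∈ A s → (p : V) ∈ A s}
  have hU : ∀ p, IsOpen (U p) := by
    intro p
    have : U p = ⋂ s, {y : S | (y : V) ∈ A s → (p : V) ∈ A s} := by ext; simp [U]
    rw [this]
    refine isOpen_iInter_of_finite fun s => ?_
    by_cases h : (p : V) ∈ A s
    · simp [h]
    · simp only [h, imp_false]
      exact ((hAc s).isClosed.preimage continuous_subtype_val).isOpen_compl
  obtain ⟨δ, hδ, hL⟩ := lebesgue_number_lemma_of_metric (isCompact_univ (X := S)) hU
    (fun y _ => Set.mem_iUnion.2 ⟨y, fun s h => h⟩)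
  let t : S → Set V := fun y => {v | ∀ s, (∃ a : S, dist a y < δ / 2 ∧ (a : V) ∈ A s) → v ∈ A s}
  have ht : ∀ y, Convex ℝ (t y) := by
    intro y a ha b hb u v hu hv huv s hs
    exact hAx s (ha s hs) (hb s hs) hu hv huv
  obtain ⟨c, hc⟩ := exists_continuous_forall_mem_convex_of_local_const ht (by
    intro y
    obtain ⟨p, hp⟩ := hL y trivial
    refine ⟨p, ?_⟩
    filter_upwards [Metric.ball_mem_nhds y (half_pos hδ)] with y' hy' s ⟨a, ha, has⟩
    refine hp ?_ s has
    have := dist_triangle a y' y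
    rw [Metric.mem_ball] at hy' ⊢
    linarith)
  refine ⟨c, fun y s hy => hc y s ⟨y, by simpa using hδ, hy⟩, fun y => ?_⟩
  obtain ⟨s, hs⟩ := Set.mem_iUnion.1 (hS ▸ y.2 : (y : V) ∈ ⋃ s, A s)
  exact ⟨_, Metric.ball_mem_nhds y (half_pos hδ), s, fun y' hy' =>
    hc y' s ⟨y, by rw [dist_comm]; exact hy', hs⟩⟩

theorem rs_indep {P : ℕ} {X : Type*} [Infinite X] (m : ℕ) (i : X → EuclideanSpace ℝ (Fin P))
    (hi : Function.Injective i) (havoid : MAvoiding m (Set.range i)) (F : Set X)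
    (hF : F.Finite) (hm : F.ncard ≤ m) : AffineIndependent ℝ (fun x : F => i x) := by
  classical
  by_contra hcon
  obtain ⟨J, hJ⟩ := Convex.radon_partition hcon
  have := hF.fintype
  let A : Finset X := J.toFinset.image Subtype.val
  let B : Finset X := (Jᶜ).toFinset.image Subtype.val
  have hAB : Disjoint A B := by
    rw [Finset.disjoint_left]
    intro x hx hx'
    simp only [A, B, Finset.mem_image, Set.mem_toFinset] at hx hx'
    obtain ⟨a, ha, rfl⟩ := hx
    obtain ⟨b, hb, hab⟩ := hx'
    rw [Subtype.ext hab] at hb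
    exact hb ha
  have hABF : (A ∪ B).card ≤ m := by
    refine le_trans ?_ hm
    rw [Set.ncard_eq_toFinset_card' F]
    apply Finset.card_le_card
    intro x hx
    simp only [A, B, Finset.mem_union, Finset.mem_image] at hx
    rw [Set.mem_toFinset]
    obtain ⟨a, _, rfl⟩ | ⟨a, _, rfl⟩ := hx <;> exact a.2
  rw [Finset.card_union_of_disjoint hAB] at hABF
  -- extend `A` inside the complement of `B`, then `B` inside the complement of the extension
  have ext : ∀ C D : Finset X, Disjoint C D → C.card ≤ m →
      ∃ C' : Finset X, C ⊆ C' ∧ Disjoint C' D ∧ C'.card = m := by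
    intro C D hCD hC
    have hinf : Infinite {x // x ∉ D} := (Set.Finite.infinite_compl D.finite_toSet).to_subtype
    obtain ⟨T, hT, hTc⟩ := Infinite.exists_superset_card_eq (C.subtype (· ∉ D)) m
      (by
        rw [Finset.card_subtype]
        exact (Finset.card_filter_le _ _).trans hC)
    refine ⟨T.map (Function.Embedding.subtype _), ?_, ?_, by simpa using hTc⟩
    · intro x hx
      have hxD : x ∉ D := Finset.disjoint_left.1 hCD hx
      exact Finset.mem_map.2 ⟨⟨x, hxD⟩, hT (Finset.mem_subtype.2 hx), rfl⟩
    · rw [Finset.disjoint_left]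
      intro x hx
      obtain ⟨a, _, rfl⟩ := Finset.mem_map.1 hx
      exact a.2
  obtain ⟨A', hA', hdA, hcA⟩ := ext A B hAB (by omega)
  obtain ⟨B', hB', hdB, hcB⟩ := ext B A' hdA.symm (by omega)
  have hdis := havoid (A'.image i) (B'.image i) (by simp [Set.image_subset_range])
    (by simp [Set.image_subset_range])
    (by rw [Finset.card_image_of_injective _ hi, hcA])
    (by rw [Finset.card_image_of_injective _ hi, hcB])
    ((Finset.disjoint_image hi).2 hdB.symm)
  obtain ⟨z, hz1, hz2⟩ := hJ
  refine Set.disjoint_left.1 hdis (convexHull_mono ?_ hz1) (convexHull_mono ?_ hz2)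
  · rintro _ ⟨a, ha, rfl⟩
    rw [Finset.coe_image]
    exact ⟨a, hA' (Finset.mem_image_of_mem _ (Set.mem_toFinset.2 ha)), rfl⟩
  · rintro _ ⟨a, ha, rfl⟩
    rw [Finset.coe_image]
    exact ⟨a, hB' (Finset.mem_image_of_mem _ (Set.mem_toFinset.2 ha)), rfl⟩

/-- Lifting a face-preserving homotopy through a map which is injective on closed pieces. -/
theorem rs_liftX {X Y T ι : Type*} [TopologicalSpace X] [CompactSpace X] [T2Space X]
    [TopologicalSpace Y] [T2Space Y] [TopologicalSpace T] [Finite ι]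
    (f : X → Y) (hf : Continuous f) (B : ι → Set X) (hB : ∀ s, IsClosed (B s))
    (hcov : ∀ x, ∃ s, x ∈ B s ∧ ∀ s', x ∈ B s' → B s ⊆ B s')
    (hinj : ∀ s, Set.InjOn f (B s)) (r : C(T × Y, Y))
    (hr : ∀ s t y, y ∈ f '' B s → r (t, y) ∈ f '' B s) :
    ∃ R : C(T × X, X), (∀ t x, f (R (t, x)) = r (t, f x)) ∧
      ∀ t x s, x ∈ B s → R (t, x) ∈ B s := by
  have hex : ∀ a : T × X, ∃ x', f x' = r (a.1, f a.2) ∧ ∀ s, a.2 ∈ B s → x' ∈ B s := by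
    rintro ⟨t, x⟩
    obtain ⟨s, hs, hmin⟩ := hcov x
    obtain ⟨x', hx', hfx'⟩ := hr s t (f x) ⟨x, hs, rfl⟩
    exact ⟨x', hfx', fun s' hs' => hmin s' hs' hx'⟩
  choose R hR1 hR2 using hex
  have hcont : Continuous R := by
    refine (locallyFinite_of_finite (fun s => Prod.snd ⁻¹' B s : ι → Set (T × X))).continuous
      ?_ (fun s => (hB s).preimage continuous_snd) ?_
    · ext ⟨t, x⟩
      obtain ⟨s, hs, _⟩ := hcov x
      simp only [Set.mem_iUnion, Set.mem_preimage, Set.mem_univ, iff_true]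
      exact ⟨s, hs⟩
    · intro s
      have : CompactSpace (B s) := isCompact_iff_compactSpace.1 (hB s).isCompact
      have hemb : Topology.IsClosedEmbedding (fun x : B s => f x) :=
        Continuous.isClosedEmbedding (by fun_prop)
          (fun a b hab => Subtype.ext (hinj s a.2 b.2 hab))
      rw [continuousOn_iff_continuous_domRestrict]
      let R' : (Prod.snd ⁻¹' B s : Set (T × X)) → B s := fun a => ⟨R a.1, hR2 a.1 s a.2⟩
      have hR' : Continuous R' := by
        rw [hemb.isEmbedding.continuous_iff]
        have : (fun x : B s => f x) ∘ R' = fun a => r (a.1.1, f a.1.2) := by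
          funext a; exact hR1 a.1
        rw [this]
        fun_prop
      exact continuous_subtype_val.comp hR'
  exact ⟨⟨R, hcont⟩, fun t x => hR1 (t, x), fun t x s hs => hR2 (t, x) s hs⟩

theorem rs_space_compact {N : ℕ} (K : SimplicialComplex ℝ (EuclideanSpace ℝ (Fin N)))
    (hK : K.faces.Finite) : CompactSpace K.space := by
  refine isCompact_iff_compactSpace.1 ?_
  exact hK.isCompact_biUnion fun s _ => s.finite_toSet.isCompact_convexHull ℝ

open unitInterval Topology in
/-- Let `f : X → Y` be a surjective simplicial map between (the underlying spaces
of) finite simplicial complexes, with all fibers of cardinality at most `m`, and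
let `i : X → ℝ^P` be an embedding with `m`-avoiding image.  Then the simplicial
resolution `X^Δ = {(y,z) : z ∈ conv(i(f⁻¹ y))}` is homotopy equivalent to `Y`
via the projection `f^Δ (y,z) = y`. -/
theorem stmt9 {N M P : ℕ} (m : ℕ)
    (K : SimplicialComplex ℝ (EuclideanSpace ℝ (Fin N)))
    (L : SimplicialComplex ℝ (EuclideanSpace ℝ (Fin M)))
    (hK : K.faces.Finite) (hL : L.faces.Finite)
    (f : K.space → L.space) (hf : Continuous f) (hsurj : Function.Surjective f)
    (hsimplicial : ∀ s ∈ K.faces, ∃ t ∈ L.faces,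
      ∃ g : EuclideanSpace ℝ (Fin N) →ᵃ[ℝ] EuclideanSpace ℝ (Fin M),
        (∀ x ∈ convexHull ℝ ((s : Finset _) : Set (EuclideanSpace ℝ (Fin N))),
          g x ∈ convexHull ℝ ((t : Finset _) : Set (EuclideanSpace ℝ (Fin M)))) ∧
        ∀ (x : K.space), (x : EuclideanSpace ℝ (Fin N)) ∈
            convexHull ℝ ((s : Finset _) : Set (EuclideanSpace ℝ (Fin N))) →
          (f x : EuclideanSpace ℝ (Fin M)) = g x)
    (hfib : ∀ y : L.space, (f ⁻¹' {y}).Finite ∧ (f ⁻¹' {y}).ncard ≤ m)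
    (i : K.space → EuclideanSpace ℝ (Fin P))
    (hi : Topology.IsEmbedding i) (havoid : MAvoiding m (Set.range i)) :
    ∃ h : ContinuousMap.HomotopyEquiv
        {p : L.space × EuclideanSpace ℝ (Fin P) //
          p.2 ∈ convexHull ℝ (i '' (f ⁻¹' {p.1}))}
        L.space,
      ∀ p, h p = p.val.1 := by
  classical
  have := rs_space_compact K hK
  have := rs_space_compact L hL
  rcases finite_or_infinite K.space with hfin | hinf
  · -- finite case: everything over `L.space` is discrete
    have hfinL : Finite L.space := Finite.of_surjective f hsurj
    let g : C(L.space, EuclideanSpace ℝ (Fin P)) :=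
      ⟨fun y => i (Function.surjInv hsurj y), continuous_of_discreteTopology⟩
    exact rs_assembly (fun y => convexHull ℝ (i '' (f ⁻¹' {y}))) (fun y => convex_convexHull ℝ _)
      (ContinuousMap.id _) (ContinuousMap.Homotopic.refl _) ⟨fun a => a.2, continuous_snd⟩
      (fun _ => rfl) (fun _ => rfl) g
      (fun y => subset_convexHull ℝ _ ⟨_, Function.surjInv_eq hsurj y, rfl⟩)
  have hind : ∀ y, AffineIndependent ℝ (fun x : (f ⁻¹' {y}) => i x) := fun y =>
    rs_indep m i hi.injective havoid _ (hfib y).1 (hfib y).2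
  have : Finite K.faces := hK.to_subtype
  let B : K.faces → Set K.space := fun s => {x | (x : EuclideanSpace ℝ (Fin N)) ∈
    convexHull ℝ ((s : Finset (EuclideanSpace ℝ (Fin N))) : Set (EuclideanSpace ℝ (Fin N)))}
  have hB : ∀ s, IsClosed (B s) := fun s =>
    ((s : Finset (EuclideanSpace ℝ (Fin N))).finite_toSet.isCompact_convexHull ℝ).isClosed.preimage continuous_subtype_val
  have hcov : ∀ x, ∃ s, x ∈ B s ∧ ∀ s', x ∈ B s' → B s ⊆ B s' := by
    intro x
    obtain ⟨s0, hs0, hx0⟩ := SimplicialComplex.mem_space_iff.1 x.2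
    obtain ⟨s, hs, hmin⟩ := Set.exists_min_image {s : K.faces | x ∈ B s}
      (fun s => (s : Finset (EuclideanSpace ℝ (Fin N))).card) (Set.toFinite _) ⟨⟨s0, hs0⟩, hx0⟩
    refine ⟨s, hs, fun s' hs' => ?_⟩
    have hx := K.inter_subset_convexHull s.2 s'.2 ⟨hs, hs'⟩
    rw [← Finset.coe_inter] at hx
    have hne : ((s : Finset (EuclideanSpace ℝ (Fin N))) ∩ (s' : Finset (EuclideanSpace ℝ (Fin N)))).Nonempty := by
      rw [← Finset.coe_nonempty, ← convexHull_nonempty_iff (𝕜 := ℝ)]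
      exact ⟨_, hx⟩
    have hle := hmin ⟨_, K.down_closed s.2 Finset.inter_subset_left hne⟩ hx
    have heq := Finset.eq_of_subset_of_card_le
      (Finset.inter_subset_left (s₁ := (s : Finset (EuclideanSpace ℝ (Fin N)))) (s₂ := (s' : Finset (EuclideanSpace ℝ (Fin N))))) hle
    have hss : (s : Finset (EuclideanSpace ℝ (Fin N))) ⊆ (s' : Finset (EuclideanSpace ℝ (Fin N))) := Finset.inter_eq_left.1 heq
    exact fun z hz => convexHull_mono (Finset.coe_subset.2 hss) hz
  have hg : ∀ s : K.faces, ∃ g : EuclideanSpace ℝ (Fin N) →ᵃ[ℝ] EuclideanSpace ℝ (Fin M),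
      ∀ x ∈ B s, (f x : EuclideanSpace ℝ (Fin M)) = g x := by
    intro s
    obtain ⟨_, _, g, _, h⟩ := hsimplicial s s.2
    exact ⟨g, h⟩
  choose g hg using hg
  have hinj : ∀ s, Set.InjOn f (B s) := by
    intro s a ha b hb hab
    by_contra hne
    have hne' : (a : EuclideanSpace ℝ (Fin N)) ≠ b := fun h => hne (Subtype.ext h)
    have hseg : ∀ t : I, AffineMap.lineMap (a : EuclideanSpace ℝ (Fin N)) b (t : ℝ) ∈
        convexHull ℝ ((s : Finset (EuclideanSpace ℝ (Fin N))) : Set (EuclideanSpace ℝ (Fin N))) :=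
      fun t => (convex_convexHull ℝ _).lineMap_mem ha hb t.2
    let γ : I → K.space := fun t =>
      ⟨_, SimplicialComplex.convexHull_subset_space s.2 (hseg t)⟩
    have hγ : Function.Injective γ := by
      intro t t' htt
      have : AffineMap.lineMap (a : EuclideanSpace ℝ (Fin N)) b (t : ℝ) =
        AffineMap.lineMap (a : EuclideanSpace ℝ (Fin N)) b (t' : ℝ) := congrArg Subtype.val htt
      exact Subtype.ext (AffineMap.lineMap_injective ℝ hne' this)
    have hsub : Set.range γ ⊆ f ⁻¹' {f a} := by
      rintro _ ⟨t, rfl⟩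
      apply Subtype.ext
      have hgab : g s a = g s b := by rw [← hg s a ha, ← hg s b hb, hab]
      rw [hg s (γ t) (hseg t), hg s a ha]
      change g s (AffineMap.lineMap (a : EuclideanSpace ℝ (Fin N)) b (t : ℝ)) = _
      rw [AffineMap.apply_lineMap, ← hgab, AffineMap.lineMap_same_apply]
    have : Infinite I := (Set.Icc_infinite (zero_lt_one (α := ℝ))).to_subtype
    exact Set.infinite_range_of_injective hγ ((hfib (f a)).1.subset hsub)
  let A : K.faces → Set (EuclideanSpace ℝ (Fin M)) := fun s => (fun x => (f x : _)) '' B s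
  have hAmem : ∀ s (y : L.space), (y : EuclideanSpace ℝ (Fin M)) ∈ A s ↔ y ∈ f '' B s := by
    intro s y
    constructor
    · rintro ⟨x, hx, h⟩
      exact ⟨x, hx, Subtype.ext h⟩
    · rintro ⟨x, hx, rfl⟩
      exact ⟨x, hx, rfl⟩
  have hAc : ∀ s, IsCompact (A s) := fun s => (hB s).isCompact.image (by fun_prop)
  have hAx : ∀ s, Convex ℝ (A s) := by
    intro s
    have : A s = g s '' convexHull ℝ
        ((s : Finset (EuclideanSpace ℝ (Fin N))) : Set (EuclideanSpace ℝ (Fin N))) := by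
      ext y
      constructor
      · rintro ⟨x, hx, rfl⟩
        exact ⟨x, hx, (hg s x hx).symm⟩
      · rintro ⟨x, hx, rfl⟩
        exact ⟨⟨x, SimplicialComplex.convexHull_subset_space s.2 hx⟩, hx, hg s _ hx⟩
    rw [this]
    exact (convex_convexHull ℝ _).affine_image _
  have hAL : ∀ s, A s ⊆ L.space := by
    rintro s _ ⟨x, _, rfl⟩
    exact (f x).2
  have hcovA : ∀ y : L.space, ∃ s, (y : EuclideanSpace ℝ (Fin M)) ∈ A s := by
    intro y
    obtain ⟨x, rfl⟩ := hsurj y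
    obtain ⟨s, hs, _⟩ := hcov x
    exact ⟨s, x, hs, rfl⟩
  have hS : L.space = ⋃ s, A s := by
    apply Set.Subset.antisymm
    · intro y hy
      exact Set.mem_iUnion.2 (hcovA ⟨y, hy⟩)
    · exact Set.iUnion_subset hAL
  obtain ⟨c, hcA, hcloc⟩ := rs_center L.space A hAc hAx hS
  have hrA : ∀ (t : I) (y : L.space) s, (y : EuclideanSpace ℝ (Fin M)) ∈ A s →
      (1 - (t : ℝ)) • (y : EuclideanSpace ℝ (Fin M)) + (t : ℝ) • c y ∈ A s := fun t y s hy =>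
    hAx s hy (hcA y s hy) (by have := t.2.2; linarith) t.2.1 (by ring)
  let r : C(I × L.space, L.space) :=
    ⟨fun a => ⟨(1 - (a.1 : ℝ)) • (a.2 : EuclideanSpace ℝ (Fin M)) + (a.1 : ℝ) • c a.2, by
      obtain ⟨s, hs⟩ := hcovA a.2
      exact hAL s (hrA a.1 a.2 s hs)⟩, by fun_prop⟩
  let c' : C(L.space, L.space) := ⟨fun y => r (1, y), by fun_prop⟩
  have hc' : ∀ y, (c' y : EuclideanSpace ℝ (Fin M)) = c y := by intro y; simp [c', r]
  have hr0 : ∀ y, r (0, y) = y := by intro y; simp [r]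
  obtain ⟨R, hR, hRB⟩ := rs_liftX f hf B hB hcov hinj r (fun s t y hy =>
    (hAmem s _).1 (hrA t y s ((hAmem s y).2 hy)))
  have hR0 : ∀ x, R (0, x) = x := by
    intro x
    obtain ⟨s, hs, _⟩ := hcov x
    exact hinj s (hRB 0 x s hs) hs (by rw [hR, hr0])
  obtain ⟨H, H0, H1⟩ := rs_lift m f hf i hi.continuous hfib hind r R hR hR0 hr0
  have hsec : ∀ y : L.space, ∃ U ∈ 𝓝 y, ∃ ξ : L.space → EuclideanSpace ℝ (Fin P),
      ContinuousOn ξ U ∧ ∀ y' ∈ U, ξ y' ∈ convexHull ℝ (i '' (f ⁻¹' {c' y'})) := by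
    intro y
    obtain ⟨U, hU, s, hs⟩ := hcloc y
    have hs' : ∀ y' ∈ U, ∃ x ∈ B s, f x = c' y' := fun y' hy' =>
      (hAmem s _).1 (by rw [hc']; exact hs y' hy')
    have hex : ∀ y' : L.space, ∃ x : K.space, y' ∈ U → x ∈ B s ∧ f x = c' y' := by
      intro y'
      by_cases h : y' ∈ U
      · obtain ⟨x, hx⟩ := hs' y' h
        exact ⟨x, fun _ => hx⟩
      · exact ⟨Classical.arbitrary _, fun h' => absurd h' h⟩
    choose ξ hξ using hex
    refine ⟨U, hU, fun y' => i (ξ y'), ?_, fun y' hy' =>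
      subset_convexHull ℝ _ ⟨_, (hξ y' hy').2, rfl⟩⟩
    refine hi.continuous.comp_continuousOn ?_
    have : CompactSpace (B s) := isCompact_iff_compactSpace.1 (hB s).isCompact
    have hemb : Topology.IsClosedEmbedding (fun x : B s => f x) :=
      Continuous.isClosedEmbedding (by fun_prop)
        (fun a b hab => Subtype.ext (hinj s a.2 b.2 hab))
    rw [continuousOn_iff_continuous_domRestrict]
    let ξ' : U → B s := fun a => ⟨ξ a.1, (hξ a.1 a.2).1⟩
    have hξ' : Continuous ξ' := by
      rw [hemb.isEmbedding.continuous_iff]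
      have : (fun x : B s => f x) ∘ ξ' = fun a => c' a.1 := by
        funext a; exact (hξ a.1 a.2).2
      rw [this]
      fun_prop
    exact continuous_subtype_val.comp hξ'
  obtain ⟨G, hG⟩ := exists_continuous_forall_mem_convex_of_local
    (fun y => convex_convexHull ℝ (i '' (f ⁻¹' {c' y}))) hsec
  exact rs_assembly (fun y => convexHull ℝ (i '' (f ⁻¹' {y}))) (fun y => convex_convexHull ℝ _)
    c' ⟨⟨r, hr0, fun _ => rfl⟩⟩ H H0 (fun e => H1 1 e) G hG
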